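/- arXiv:2212.01752 — 3 statements merged into one kernel-verified Lean document; each statement's English description precedes it below -/
import Mathlib

section
/- Let Z > 0, ω > 0 and r ∈ ℝ be constants, and for T > 0 define F(T) = Z · exp(max(0, −r)·T) · ∫₀ᵀ exp(r·s) ds. Then F is strictly increasing on (0, ∞), and F(T) < ω holds if and only if T < T_max, where T_max = (1/|r|)·ln(ω·|r|/Z + 1) when r ≠ 0 and T_max = ω/Z when r = 0. In particular, the set of all T > 0 satisfying F(T) < ω is exactly the open interval (0, T_max). -/
open Real Set

theorem integral_exp_const_mul {c : ℝ} (hc : c ≠ 0) (T : ℝ) :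
    ∫ s in (0:ℝ)..T, Real.exp (c * s) = (Real.exp (c * T) - 1) / c := by
  rw [intervalIntegral.integral_comp_mul_left (fun x => Real.exp x) hc, integral_exp]
  simp [div_eq_inv_mul]

theorem exp_max_mul_integral_exp {r : ℝ} (hr : r ≠ 0) (T : ℝ) :
    Real.exp (max 0 (-r) * T) * ∫ s in (0:ℝ)..T, Real.exp (r * s) =
      (Real.exp (|r| * T) - 1) / |r| := by
  rw [integral_exp_const_mul hr]
  rcases lt_or_gt_of_ne hr with h | h
  · have hexp : Real.exp (-r * T) * Real.exp (r * T) = 1 := by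
      rw [← Real.exp_add]
      simp
    rw [max_eq_right (by linarith), abs_of_neg h, div_neg, ← neg_div, mul_div_assoc',
      mul_sub, hexp]
    ring
  · rw [max_eq_left (by linarith), abs_of_pos h]
    simp

/-- The set of sampling periods `T > 0` satisfying the small-gain condition
`Z · exp(max(0,−r)·T) · ∫₀ᵀ e^{rs} ds < ω` is exactly the interval `(0, T_max)`,
where `T_max = (1/|r|)·ln(ω·|r|/Z + 1)` if `r ≠ 0` and `T_max = ω/Z` if `r = 0`;
moreover the left-hand side is strictly increasing in `T` on `(0, ∞)`. -/
theorem stmt_0 (Z ω r : ℝ) (hZ : 0 < Z) (hω : 0 < ω)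
    (F : ℝ → ℝ)
    (hF : ∀ T : ℝ, F T = Z * Real.exp (max 0 (-r) * T) * ∫ s in (0:ℝ)..T, Real.exp (r * s))
    (Tmax : ℝ)
    (hTmax : Tmax = if r ≠ 0 then (1 / |r|) * Real.log (ω * |r| / Z + 1) else ω / Z) :
    StrictMonoOn F (Set.Ioi 0) ∧
    (∀ T : ℝ, 0 < T → (F T < ω ↔ T < Tmax)) ∧
    {T : ℝ | 0 < T ∧ F T < ω} = Set.Ioo 0 Tmax := by
  have hlt : ∀ T : ℝ, F T < ω ↔ T < Tmax := by
    intro T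
    by_cases hr : r = 0
    · rw [hTmax, if_neg (not_not.mpr hr), hF, lt_div_iff₀ hZ]
      simp [hr, mul_comm]
    · have ha : 0 < |r| := abs_pos.mpr hr
      have hX : 0 < ω * |r| / Z + 1 := by positivity
      rw [hTmax, if_pos hr, hF, mul_assoc,
        exp_max_mul_integral_exp hr, one_div, inv_mul_eq_div, lt_div_iff₀ ha, mul_comm T,
        Real.lt_log_iff_exp_lt hX, ← sub_lt_iff_lt_add, lt_div_iff₀ hZ, mul_div_assoc',
        div_lt_iff₀ ha, mul_comm Z]
  refine ⟨?_, fun T _ => hlt T, ?_⟩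
  · intro x _ y _ hxy
    rw [hF, hF]
    by_cases hr : r = 0
    · simpa [hr] using mul_lt_mul_of_pos_left hxy hZ
    · have ha : 0 < |r| := abs_pos.mpr hr
      rw [mul_assoc, mul_assoc, exp_max_mul_integral_exp hr, exp_max_mul_integral_exp hr]
      gcongr
  · ext T
    simp [hlt]
end

section
/- Let N ≥ 0 be an integer, let A_N be the (N+1)×(N+1) real diagonal matrix with diagonal entries μ₀, …, μ_N, and let C_N be the real row vector (c₀, …, c_N). If μ_n ≠ μ_m for all pairs of indices n ≠ m in {0, …, N} and c_n ≠ 0 for all n = 0, …, N, then there exists a column vector L ∈ ℝ^{N+1} such that the matrix A_N + L·C_N is Hurwitz, i.e., every complex eigenvalue z of A_N + L·C_N satisfies Re z < 0. -/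
open Polynomial in
/-- The partial fraction expansion of `(z - s) ^ n / ∏ i, (z - v i)`. -/
theorem pow_sub_eq_nodal_mul_one_add_sum {F ι : Type*} [Field F] [Fintype ι] [DecidableEq ι]
    {v : ι → F} (hv : Function.Injective v) (s : F) {z : F} (hz : ∀ i, z ≠ v i) :
    (z - s) ^ Fintype.card ι = (Lagrange.nodal Finset.univ v).eval z *
      (1 + ∑ i, Lagrange.nodalWeight Finset.univ v i * (z - v i)⁻¹ *
        (v i - s) ^ Fintype.card ι) := by
  have hdeg : ((X - C s) ^ Fintype.card ι - Lagrange.nodal Finset.univ v).degree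
      < ((Finset.univ : Finset ι).card : WithBot ℕ) := by
    have hmonic := (monic_X_sub_C s).pow (Fintype.card ι)
    have h : ((X - C s) ^ Fintype.card ι).degree = (Fintype.card ι : WithBot ℕ) := by simp
    refine (degree_sub_lt_left ?_ hmonic.ne_zero ?_).trans_eq h
    · rw [h, Lagrange.degree_nodal, Finset.card_univ]
    · rw [hmonic.leadingCoeff, Lagrange.nodal_monic.leadingCoeff]
  have h := congrArg (eval z) (Lagrange.eq_interpolate_of_eval_eq
    (fun i ↦ (v i - s) ^ Fintype.card ι) hv.injOn hdeg fun i hi ↦ by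
      simp [Lagrange.eval_nodal_at_node hi])
  rw [Lagrange.eval_interpolate_not_at_node _ fun i _ ↦ hz i] at h
  simp only [eval_sub, eval_pow, eval_X, eval_C] at h
  linear_combination h

/-- If the `L i` do not vanish, an eigenvalue `z` of `diagonal v + vecMulVec L c` is not one of the
`v i` and satisfies the secular equation. -/
theorem secular_equation_of_mem_spectrum {F ι : Type*} [Field F] [Fintype ι] [DecidableEq ι]
    {v L c : ι → F} (hv : Function.Injective v) (hL : ∀ i, L i ≠ 0) (hc : ∀ i, c i ≠ 0) {z : F}
    (hz : z ∈ spectrum F (Matrix.diagonal v + Matrix.vecMulVec L c)) :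
    (∀ i, z ≠ v i) ∧ ∑ i, c i * L i * (z - v i)⁻¹ = 1 := by
  rw [← Matrix.spectrum_toLin', ← Module.End.hasEigenvalue_iff_mem_spectrum] at hz
  obtain ⟨x, hx⟩ := hz.exists_hasEigenvector
  have hxi (i : ι) : (z - v i) * x i = L i * (c ⬝ᵥ x) := by
    have h := congrFun hx.apply_eq_smul i
    simp only [Matrix.toLin'_apply, Matrix.add_mulVec, Matrix.vecMulVec_mulVec, Pi.add_apply,
      Matrix.mulVec_diagonal, Pi.smul_apply, smul_eq_mul, MulOpposite.smul_eq_mul_unop,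
      MulOpposite.unop_op] at h
    linear_combination -h
  have hcx : c ⬝ᵥ x ≠ 0 := by
    intro h0
    obtain ⟨k, hk⟩ := Function.ne_iff.mp hx.2
    have hzk : z = v k := by
      have := hxi k
      rw [h0, mul_zero, mul_eq_zero] at this
      exact sub_eq_zero.mp (this.resolve_right hk)
    have hsum : c ⬝ᵥ x = c k * x k := by
      refine Finset.sum_eq_single k (fun i _ hik ↦ ?_) (by simp)
      have := hxi i
      rw [h0, mul_zero, mul_eq_zero, hzk, sub_eq_zero] at this
      rw [this.resolve_left fun h ↦ hik (hv h).symm, mul_zero]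
    exact mul_ne_zero (hc k) hk (hsum ▸ h0)
  have hzv (i : ι) : z ≠ v i := fun h ↦ mul_ne_zero (hL i) hcx (by rw [← hxi, h]; simp)
  refine ⟨hzv, mul_right_cancel₀ hcx ?_⟩
  rw [one_mul, Finset.sum_mul]
  refine Finset.sum_congr rfl fun i _ ↦ ?_
  have := sub_ne_zero.mpr (hzv i)
  field_simp
  linear_combination -c i * hxi i

/-- If the `μ_n` are pairwise distinct and all `c_n` are nonzero (Assumption (B)),
then there is an output-injection gain `L` making `A_N + L·C_N` Hurwitz, i.e. every
complex eigenvalue of `A_N + L·C_N` has strictly negative real part (Assumption (A)). -/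
theorem stmt_4 (N : ℕ) (μ c : Fin (N + 1) → ℝ)
    (hμ : ∀ n m : Fin (N + 1), n ≠ m → μ n ≠ μ m)
    (hc : ∀ n : Fin (N + 1), c n ≠ 0) :
    ∃ L : Fin (N + 1) → ℝ,
      ∀ z : ℂ,
        z ∈ spectrum ℂ ((Matrix.diagonal μ + Matrix.vecMulVec L c).map (Complex.ofReal ·)) →
          z.re < 0 := by
  obtain ⟨s, hs, hs0⟩ : ∃ s : ℝ, s ∉ Set.range μ ∧ s < 0 := by
    obtain ⟨s, hs0, hs⟩ := ((Set.Iio_infinite (0 : ℝ)).sdiff (Set.finite_range μ)).nonempty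
    exact ⟨s, hs, hs0⟩
  have hinj : Function.Injective μ := fun n m h ↦ by_contra fun hne ↦ hμ n m hne h
  let L (n : Fin (N + 1)) : ℝ :=
    -(Lagrange.nodalWeight Finset.univ μ n * (μ n - s) ^ Fintype.card (Fin (N + 1))) / c n
  have hL (n : Fin (N + 1)) : L n ≠ 0 :=
    div_ne_zero (neg_ne_zero.mpr (mul_ne_zero
      (Lagrange.nodalWeight_ne_zero hinj.injOn (Finset.mem_univ n))
      (pow_ne_zero _ (sub_ne_zero.mpr fun h ↦ hs ⟨n, h⟩)))) (hc n)
  refine ⟨L, fun z hz ↦ ?_⟩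
  have hmap : (Matrix.diagonal μ + Matrix.vecMulVec L c).map (Complex.ofReal ·) =
      Matrix.diagonal (fun n ↦ (μ n : ℂ)) + Matrix.vecMulVec (fun n ↦ (L n : ℂ))
        (fun n ↦ (c n : ℂ)) := by
    ext i j
    by_cases h : i = j <;> simp [Matrix.vecMulVec_apply, h]
  rw [hmap] at hz
  have hinjC : Function.Injective fun n ↦ (μ n : ℂ) := Complex.ofReal_injective.comp hinj
  obtain ⟨hzμ, hsum⟩ := secular_equation_of_mem_spectrum hinjC
    (fun n ↦ Complex.ofReal_ne_zero.mpr (hL n)) (fun n ↦ Complex.ofReal_ne_zero.mpr (hc n)) hz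
  have hcL (n : Fin (N + 1)) : (c n : ℂ) * L n * (z - μ n)⁻¹ =
      -(Lagrange.nodalWeight Finset.univ (fun n ↦ (μ n : ℂ)) n * (z - μ n)⁻¹ *
        ((μ n : ℂ) - s) ^ Fintype.card (Fin (N + 1))) := by
    have hcn : (c n : ℂ) ≠ 0 := Complex.ofReal_ne_zero.mpr (hc n)
    have hweight : ((Lagrange.nodalWeight Finset.univ μ n : ℝ) : ℂ) =
        Lagrange.nodalWeight Finset.univ (fun n ↦ (μ n : ℂ)) n := by
      simp [Lagrange.nodalWeight]
    simp only [L, Complex.ofReal_div, Complex.ofReal_neg, Complex.ofReal_mul, Complex.ofReal_pow,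
      Complex.ofReal_sub, hweight]
    rw [mul_div_cancel₀ _ hcn]
    ring
  simp only [hcL, Finset.sum_neg_distrib] at hsum
  have hpow := pow_sub_eq_nodal_mul_one_add_sum hinjC (s : ℂ) hzμ
  rw [neg_eq_iff_eq_neg.mp hsum, add_neg_cancel, mul_zero] at hpow
  rw [sub_eq_zero.mp (eq_zero_of_pow_eq_zero hpow), Complex.ofReal_re]
  exact hs0
end

section
/- Let q, r ∈ ℝ and let φ, g, k : [0,1] → ℝ be continuous. Let σ ∈ ℝ satisfy σ ≥ (1/2)·(‖φ‖ + ‖k‖) + max(‖g‖·‖φ‖ + q²/2, −r), where ‖f‖ = (∫₀¹ f(x)² dx)^{1/2}. Then for all four times continuously differentiable functions u, û : [0,1] → ℝ satisfying u'(0) = u'''(0) = u'(1) = u'''(1) = 0 and û'(0) = û'''(0) = û'(1) = û'''(1) = 0, and for every w ∈ ℝ: ⟨u'''' + q·u'', u⟩ + ⟨û'''' + q·û'', û⟩ − ⟨g, û⟩·⟨φ, û⟩ + ⟨φ, û⟩·w − w·⟨k, û⟩ + σ·‖u‖² + σ·‖û‖² + (σ + r)·w² ≥ 0. -/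
/-- The `L²(0,1)` inner product `⟨f, g⟩ = ∫₀¹ f g`. -/
noncomputable def ip (f g : ℝ → ℝ) : ℝ := ∫ x in (0:ℝ)..1, f x * g x

/-- The `L²(0,1)` norm `‖f‖ = (∫₀¹ f²)^{1/2}`. -/
noncomputable def nrm (f : ℝ → ℝ) : ℝ := Real.sqrt (∫ x in (0:ℝ)..1, f x ^ 2)

open Set intervalIntegral in
theorem abs_ip_le_nrm_mul_nrm {f g : ℝ → ℝ} (hf : ContinuousOn f (Icc 0 1))
    (hg : ContinuousOn g (Icc 0 1)) : |ip f g| ≤ nrm f * nrm g := by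
  have I : ∀ {h : ℝ → ℝ}, ContinuousOn h (Icc 0 1) →
      IntervalIntegrable h MeasureTheory.volume 0 1 := fun hh =>
    ContinuousOn.intervalIntegrable (by rwa [uIcc_of_le zero_le_one])
  have key : ∀ t : ℝ, 0 ≤ (∫ x in (0:ℝ)..1, g x ^ 2) * (t * t) + (2 * ip f g) * t
      + ∫ x in (0:ℝ)..1, f x ^ 2 := by
    intro t
    have h0 : 0 ≤ ∫ x in (0:ℝ)..1, (f x + t * g x) ^ 2 :=
      integral_nonneg zero_le_one fun _ _ => sq_nonneg _
    have h1 : ∫ x in (0:ℝ)..1, (f x + t * g x) ^ 2 =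
        ∫ x in (0:ℝ)..1, (t * t) * g x ^ 2 + (2 * t) * (f x * g x) + f x ^ 2 :=
      integral_congr fun x _ => by ring
    have i1 : IntervalIntegrable (fun x => (t * t) * g x ^ 2) MeasureTheory.volume 0 1 :=
      (I (hg.pow 2)).const_mul _
    have i2 : IntervalIntegrable (fun x => (2 * t) * (f x * g x)) MeasureTheory.volume 0 1 :=
      (I (hf.mul hg)).const_mul _
    have i3 : IntervalIntegrable (fun x => f x ^ 2) MeasureTheory.volume 0 1 := I (hf.pow 2)
    rw [h1, integral_add (i1.add i2) i3, integral_add i1 i2,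
      integral_const_mul, integral_const_mul] at h0
    unfold ip
    linarith
  have hd := discrim_le_zero key
  unfold discrim at hd
  unfold nrm
  rw [← Real.sqrt_mul (integral_nonneg zero_le_one fun _ _ => sq_nonneg _)]
  exact Real.abs_le_sqrt (by linarith)

theorem nrm_sq (f : ℝ → ℝ) : nrm f ^ 2 = ∫ x in (0:ℝ)..1, f x ^ 2 :=
  Real.sq_sqrt (intervalIntegral.integral_nonneg zero_le_one fun _ _ => sq_nonneg _)

theorem integral_iteratedDeriv_four_mul_self {u : ℝ → ℝ} (hu : ContDiff ℝ 4 u)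
    (h10 : deriv u 0 = 0) (h30 : iteratedDeriv 3 u 0 = 0)
    (h11 : deriv u 1 = 0) (h31 : iteratedDeriv 3 u 1 = 0) :
    ∫ x in (0:ℝ)..1, (iteratedDeriv 4 u x * u x - iteratedDeriv 2 u x ^ 2) = 0 := by
  have hD : ∀ n : ℕ, n < 4 → ∀ x,
      HasDerivAt (iteratedDeriv n u) (iteratedDeriv (n + 1) u x) x := by
    intro n hn x
    rw [iteratedDeriv_succ]
    exact (hu.differentiable_iteratedDeriv n (by exact_mod_cast hn) x).hasDerivAt
  have c4 : Continuous (iteratedDeriv 4 u) := hu.continuous_iteratedDeriv 4 le_rfl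
  have c2 : Continuous (iteratedDeriv 2 u) := hu.continuous_iteratedDeriv 2 (by norm_num)
  have c0 : Continuous u := hu.continuous
  have hF : ∀ x, HasDerivAt
      (fun x => iteratedDeriv 3 u x * u x - iteratedDeriv 2 u x * deriv u x)
      (iteratedDeriv 4 u x * u x - iteratedDeriv 2 u x ^ 2) x := by
    intro x
    have d0 := hD 0 (by norm_num) x
    have d1 := hD 1 (by norm_num) x
    simp only [zero_add, iteratedDeriv_zero, iteratedDeriv_one] at d0 d1
    exact (((hD 3 (by norm_num) x).fun_mul d0).fun_sub
      ((hD 2 (by norm_num) x).fun_mul d1)).congr_deriv (by norm_num; ring)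
  rw [intervalIntegral.integral_eq_sub_of_hasDerivAt (fun x _ => hF x)
    (((c4.mul c0).sub (c2.pow 2)).intervalIntegrable 0 1)]
  simp [h10, h30, h11, h31]

theorem ip_iteratedDeriv_add_nonneg (q : ℝ) {u : ℝ → ℝ} (hu : ContDiff ℝ 4 u)
    (h10 : deriv u 0 = 0) (h30 : iteratedDeriv 3 u 0 = 0)
    (h11 : deriv u 1 = 0) (h31 : iteratedDeriv 3 u 1 = 0) :
    0 ≤ ip (fun x => iteratedDeriv 4 u x + q * iteratedDeriv 2 u x) u
      + q ^ 2 / 2 * nrm u ^ 2 := by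
  have c4 : Continuous (iteratedDeriv 4 u) := hu.continuous_iteratedDeriv 4 le_rfl
  have c2 : Continuous (iteratedDeriv 2 u) := hu.continuous_iteratedDeriv 2 (by norm_num)
  have c0 : Continuous u := hu.continuous
  rw [nrm_sq, ip, ← intervalIntegral.integral_const_mul, ← intervalIntegral.integral_add
    (Continuous.intervalIntegrable (by fun_prop) _ _)
    (Continuous.intervalIntegrable (by fun_prop) _ _)]
  refine (integral_iteratedDeriv_four_mul_self hu h10 h30 h11 h31).ge.trans ?_
  refine intervalIntegral.integral_mono_on zero_le_one
    (Continuous.intervalIntegrable (by fun_prop) _ _)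
    (Continuous.intervalIntegrable (by fun_prop) _ _) fun x _ => ?_
  nlinarith [sq_nonneg (iteratedDeriv 2 u x + q / 2 * u x), sq_nonneg (q * u x)]

/-- The monotonicity estimate of Proposition 1: for
`σ ≥ (1/2)(‖φ‖ + ‖k‖) + max(‖g‖‖φ‖ + q²/2, −r)` and all `u, û` four times continuously
differentiable with `u'(0) = u'''(0) = u'(1) = u'''(1) = 0` (and likewise for `û`),
and every `w ∈ ℝ`, the quadratic form `((A + σI)v, v)` with `v = (u, û, w)` is nonnegative. -/
theorem stmt_9 (q r : ℝ) (φ g k : ℝ → ℝ)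
    (hφ : ContinuousOn φ (Set.Icc 0 1)) (hg : ContinuousOn g (Set.Icc 0 1))
    (hk : ContinuousOn k (Set.Icc 0 1))
    (σ : ℝ)
    (hσ : σ ≥ (1 / 2) * (nrm φ + nrm k) + max (nrm g * nrm φ + q ^ 2 / 2) (-r))
    (u uh : ℝ → ℝ) (hu : ContDiff ℝ 4 u) (huh : ContDiff ℝ 4 uh)
    (hu10 : deriv u 0 = 0) (hu30 : iteratedDeriv 3 u 0 = 0)
    (hu11 : deriv u 1 = 0) (hu31 : iteratedDeriv 3 u 1 = 0)
    (huh10 : deriv uh 0 = 0) (huh30 : iteratedDeriv 3 uh 0 = 0)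
    (huh11 : deriv uh 1 = 0) (huh31 : iteratedDeriv 3 uh 1 = 0)
    (w : ℝ) :
    ip (fun x => iteratedDeriv 4 u x + q * iteratedDeriv 2 u x) u +
        ip (fun x => iteratedDeriv 4 uh x + q * iteratedDeriv 2 uh x) uh -
        ip g uh * ip φ uh + ip φ uh * w - w * ip k uh +
        σ * nrm u ^ 2 + σ * nrm uh ^ 2 + (σ + r) * w ^ 2 ≥ 0 := by
  have hU := ip_iteratedDeriv_add_nonneg q hu hu10 hu30 hu11 hu31
  have hV := ip_iteratedDeriv_add_nonneg q huh huh10 huh30 huh11 huh31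
  have cv : ContinuousOn uh (Set.Icc 0 1) := huh.continuous.continuousOn
  have hG := abs_ip_le_nrm_mul_nrm hg cv
  have hP := abs_ip_le_nrm_mul_nrm hφ cv
  have hK := abs_ip_le_nrm_mul_nrm hk cv
  have ng : 0 ≤ nrm g := Real.sqrt_nonneg _
  have nφ : 0 ≤ nrm φ := Real.sqrt_nonneg _
  have nk : 0 ≤ nrm k := Real.sqrt_nonneg _
  have nv : 0 ≤ nrm uh := Real.sqrt_nonneg _
  have h1 := le_max_left (nrm g * nrm φ + q ^ 2 / 2) (-r)
  have h2 := le_max_right (nrm g * nrm φ + q ^ 2 / 2) (-r)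
  have hGP : ip g uh * ip φ uh ≤ (nrm g * nrm uh) * (nrm φ * nrm uh) :=
    (le_abs_self _).trans (by rw [abs_mul]; gcongr)
  have hPw : -(ip φ uh * w) ≤ nrm φ * nrm uh * |w| :=
    (neg_le_abs _).trans (by rw [abs_mul]; gcongr)
  have hKw : w * ip k uh ≤ |w| * (nrm k * nrm uh) :=
    (le_abs_self _).trans (by rw [abs_mul]; gcongr)
  have hw : (nrm φ + nrm k) * (nrm uh * |w|) ≤
      (nrm φ + nrm k) * ((nrm uh ^ 2 + w ^ 2) / 2) := by
    gcongr
    nlinarith [sq_nonneg (nrm uh - |w|), sq_abs w]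
  have su : (q ^ 2 / 2) * nrm u ^ 2 ≤ σ * nrm u ^ 2 := by
    gcongr
    linarith [mul_nonneg ng nφ]
  have sv : (1 / 2 * (nrm φ + nrm k) + (nrm g * nrm φ + q ^ 2 / 2)) * nrm uh ^ 2 ≤
      σ * nrm uh ^ 2 := by
    gcongr
    linarith
  have sw : (1 / 2 * (nrm φ + nrm k)) * w ^ 2 ≤ (σ + r) * w ^ 2 := by
    gcongr
    linarith
  linarith
end
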